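/- arXiv:2403.16515 — 4 statements merged into one kernel-verified Lean document; each statement's English description precedes it below -/
import Mathlib

section
/- Let n ≥ 8 be an integer, let C > 0 and 0 < δ < n − 3 + 2α, and let u : (0, ∞) × (−∞, 0] → ℝ be a smooth solution of ∂_t u = ∂_r² u + ((n − 2)/r) ∂_r u + ((n − 2)/r²) u satisfying |u(r, t)| ≤ C r^{α − δ} for all (r, t) ∈ (0, ∞) × (−∞, 0]. Then u ≡ 0. -/
open Set
open Filter Topology

/-- A local maximum has nonpositive second derivative. -/
lemma IsLocalMax.nonpos_of_hasDerivAt_two {f f' : ℝ → ℝ} {x f'' : ℝ} (hmax : IsLocalMax f x)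
    (hf : ∀ᶠ y in 𝓝 x, HasDerivAt f (f' y) y) (hf' : HasDerivAt f' f'' x) : f'' ≤ 0 := by
  by_contra! hpos
  have hd : deriv f =ᶠ[𝓝 x] f' := hf.mono fun y hy => hy.deriv
  have hdd : deriv (deriv f) x = f'' := by rw [hd.deriv_eq, hf'.deriv]
  have hmin : IsLocalMin f x :=
    isLocalMin_of_deriv_deriv_pos (hdd ▸ hpos) hmax.deriv_eq_zero hf.self_of_nhds.continuousAt
  have hconst : f =ᶠ[𝓝 x] fun _ => f x := by
    filter_upwards [hmax, hmin] with y h₁ h₂ using le_antisymm h₁ h₂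
  have h0 : deriv (deriv f) x = 0 := by
    rw [hconst.deriv.deriv_eq]; simp
  linarith

/-- A function on `Iic t` which is maximal at `t` has nonnegative left derivative there. -/
lemma HasDerivWithinAt.nonneg_of_le_left {f : ℝ → ℝ} {f' a t : ℝ} (ha : a < t)
    (hf : HasDerivWithinAt f f' (Iic t) t) (hle : ∀ s ∈ Icc a t, f s ≤ f t) : 0 ≤ f' := by
  have h := (hf.mono Iio_subset_Iic_self)
  rw [hasDerivWithinAt_iff_tendsto_slope' (by simp)] at h
  refine ge_of_tendsto h ?_
  filter_upwards [Ioo_mem_nhdsLT ha] with s hs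
  rw [slope_def_field]
  exact div_nonneg_of_nonpos (sub_nonpos.2 (hle s ⟨hs.1.le, hs.2.le⟩)) (sub_nonpos.2 hs.2.le)

/-- Weak maximum principle for strict subsolutions of a one-dimensional parabolic equation
with drift `b` on a rectangle. -/
lemma parabolic_max_principle {z zt zr zrr : ℝ → ℝ → ℝ} {b : ℝ → ℝ} {r₁ r₂ t₁ t₂ : ℝ}
    (hcont : ContinuousOn (fun p : ℝ × ℝ => z p.1 p.2) (Icc r₁ r₂ ×ˢ Icc t₁ t₂))
    (ht : ∀ r ∈ Ioo r₁ r₂, ∀ t ∈ Ioc t₁ t₂, HasDerivWithinAt (z r) (zt r t) (Iic t) t)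
    (hr : ∀ r ∈ Ioo r₁ r₂, ∀ t ∈ Ioc t₁ t₂, HasDerivAt (fun x => z x t) (zr r t) r)
    (hrr : ∀ r ∈ Ioo r₁ r₂, ∀ t ∈ Ioc t₁ t₂, HasDerivAt (fun x => zr x t) (zrr r t) r)
    (hsub : ∀ r ∈ Ioo r₁ r₂, ∀ t ∈ Ioc t₁ t₂, zt r t < zrr r t + b r * zr r t)
    (hleft : ∀ t ∈ Icc t₁ t₂, z r₁ t ≤ 0) (hright : ∀ t ∈ Icc t₁ t₂, z r₂ t ≤ 0)
    (hinit : ∀ r ∈ Icc r₁ r₂, z r t₁ ≤ 0) :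
    ∀ r ∈ Icc r₁ r₂, ∀ t ∈ Icc t₁ t₂, z r t ≤ 0 := by
  intro r hr' t ht'
  obtain ⟨⟨x, s⟩, ⟨hx, hs⟩, hmax⟩ :=
    (isCompact_Icc.prod isCompact_Icc).exists_isMaxOn ⟨(r, t), hr', ht'⟩ hcont
  have hle : ∀ y ∈ Icc r₁ r₂, ∀ τ ∈ Icc t₁ t₂, z y τ ≤ z x s := fun y hy τ hτ =>
    hmax (show (y, τ) ∈ Icc r₁ r₂ ×ˢ Icc t₁ t₂ from ⟨hy, hτ⟩)
  refine (hle r hr' t ht').trans ?_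
  simp only at hx hs
  rcases hx.1.eq_or_lt with h | hx₁
  · exact h ▸ hleft s hs
  rcases hx.2.eq_or_lt with h | hx₂
  · exact h ▸ hright s hs
  rcases hs.1.eq_or_lt with h | hs₁
  · exact h ▸ hinit x hx
  exfalso
  have hxI : x ∈ Ioo r₁ r₂ := ⟨hx₁, hx₂⟩
  have hsI : s ∈ Ioc t₁ t₂ := ⟨hs₁, hs.2⟩
  have hnear : ∀ᶠ y in 𝓝 x, y ∈ Ioo r₁ r₂ := Ioo_mem_nhds hx₁ hx₂
  have hloc : IsLocalMax (fun y => z y s) x :=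
    hnear.mono fun y hy => hle y (Ioo_subset_Icc_self hy) s hs
  have h0 : zr x s = 0 := hloc.hasDerivAt_eq_zero (hr x hxI s hsI)
  have h2 : zrr x s ≤ 0 :=
    hloc.nonpos_of_hasDerivAt_two (hnear.mono fun y hy => hr y hy s hsI) (hrr x hxI s hsI)
  have h1 : 0 ≤ zt x s := (ht x hxI s hsI).nonneg_of_le_left hs₁
    fun τ hτ => hle x hx τ ⟨hτ.1, hτ.2.trans hs.2⟩
  have := hsub x hxI s hsI
  rw [h0] at this
  linarith

/-- Spatial derivative of the barrier profile `(r² + A)^p`. -/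
lemma hasDerivAt_sq_add_rpow {r A : ℝ} (h : 0 < r ^ 2 + A) (p : ℝ) :
    HasDerivAt (fun x : ℝ => (x ^ 2 + A) ^ p) (2 * r * p * (r ^ 2 + A) ^ (p - 1)) r := by
  have h1 : HasDerivAt (fun x : ℝ => x ^ 2 + A) (2 * r) r := by
    simpa using (hasDerivAt_pow 2 r).add_const A
  exact h1.rpow_const (Or.inl h.ne')

/-- A solution of the radial heat equation in (fractional) dimension `m + 1` on `r > 0` which is
at most `C r^{-2k}`, `0 < 2k < m - 1`, is dominated by a decaying self-similar supersolution. -/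
lemma radial_heat_le_barrier {v vt vr vrr : ℝ → ℝ → ℝ} {m k C : ℝ} (hC : 0 < C) (hk : 0 < k)
    (hkm : 2 * k < m - 1)
    (hcont : ContinuousOn (fun p : ℝ × ℝ => v p.1 p.2) (Ioi 0 ×ˢ Iic 0))
    (ht : ∀ r, 0 < r → ∀ t ≤ 0, HasDerivWithinAt (v r) (vt r t) (Iic 0) t)
    (hr : ∀ r, 0 < r → ∀ t ≤ 0, HasDerivAt (fun x => v x t) (vr r t) r)
    (hrr : ∀ r, 0 < r → ∀ t ≤ 0, HasDerivAt (fun x => vr x t) (vrr r t) r)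
    (heq : ∀ r, 0 < r → ∀ t ≤ 0, vt r t = vrr r t + m / r * vr r t)
    (hle : ∀ r, 0 < r → ∀ t ≤ 0, v r t ≤ C * r ^ (-(2 * k)))
    {r a t : ℝ} (hr0 : 0 < r) (hat : a ≤ t) (ht0 : t ≤ 0) :
    v r t ≤ C * (r ^ 2 + 2 * (m - 1 - 2 * k) * (t - a)) ^ (-k) := by
  set c : ℝ := 2 * (m - 1 - 2 * k) with hc
  have hc0 : 0 < c := by rw [hc]; linarith
  have hpos : ∀ x : ℝ, 0 < x → ∀ s, a ≤ s → 0 < x ^ 2 + c * (s - a) := fun x hx s hs =>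
    add_pos_of_pos_of_nonneg (by positivity) (mul_nonneg hc0.le (sub_nonneg.2 hs))
  have key : ∀ ε : ℝ, 0 < ε → v r t ≤ C * (r ^ 2 + c * (t - a)) ^ (-k)
      + ε * (r ^ (1 - m) + (1 + (t - a))) := by
    intro ε hε
    obtain ⟨r₁, hr₁, hr₁pos, hr₁r⟩ : ∃ r₁ : ℝ, C * r₁ ^ (m - 1 - 2 * k) < ε ∧ 0 < r₁ ∧ r₁ < r := by
      have h1 : Tendsto (fun x : ℝ => C * x ^ (m - 1 - 2 * k)) (𝓝[>] 0) (𝓝 0) := by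
        have : ContinuousAt (fun x : ℝ => C * x ^ (m - 1 - 2 * k)) 0 :=
          continuousAt_const.mul (Real.continuousAt_rpow_const _ _ (Or.inr (by linarith)))
        have h := this.tendsto.mono_left (nhdsWithin_le_nhds (s := Ioi 0))
        rwa [Real.zero_rpow (by linarith), mul_zero] at h
      obtain ⟨x, hx, hx'⟩ := ((h1.eventually_lt_const hε).and (Ioo_mem_nhdsGT hr0)).exists
      exact ⟨x, hx, hx'.1, hx'.2⟩
    obtain ⟨r₂, hr₂, hrr₂⟩ : ∃ r₂ : ℝ, C * r₂ ^ (-(2 * k)) < ε ∧ r < r₂ := by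
      have h1 : Tendsto (fun x : ℝ => C * x ^ (-(2 * k))) atTop (𝓝 0) := by
        simpa using (tendsto_rpow_neg_atTop (y := 2 * k) (by linarith)).const_mul C
      exact ((h1.eventually_lt_const hε).and (eventually_gt_atTop r)).exists
    have hsubset : Icc r₁ r₂ ×ˢ Icc a t ⊆ Ioi (0 : ℝ) ×ˢ Iic (0 : ℝ) := fun p hp =>
      ⟨hr₁pos.trans_le hp.1.1, hp.2.2.trans ht0⟩
    have hB : ∀ x : ℝ, 0 < x → ∀ s, a ≤ s → 0 ≤ C * (x ^ 2 + c * (s - a)) ^ (-k) :=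
      fun x hx s hs => mul_nonneg hC.le (Real.rpow_nonneg (hpos x hx s hs).le _)
    have hmain := parabolic_max_principle (b := fun x => m / x) (r₁ := r₁) (r₂ := r₂)
      (t₁ := a) (t₂ := t)
      (z := fun x s => v x s - (C * (x ^ 2 + c * (s - a)) ^ (-k)
        + ε * (x ^ (1 - m) + (1 + (s - a)))))
      (zt := fun x s => vt x s - (C * (c * (-k) * (x ^ 2 + c * (s - a)) ^ (-k - 1)) + ε))
      (zr := fun x s => vr x s - (C * (2 * x * (-k) * (x ^ 2 + c * (s - a)) ^ (-k - 1))
        + ε * ((1 - m) * x ^ (-m))))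
      (zrr := fun x s => vrr x s - (C * (2 * (-k) * (x ^ 2 + c * (s - a)) ^ (-k - 1)
        + 2 * x * (-k) * (2 * x * (-k - 1) * (x ^ 2 + c * (s - a)) ^ (-k - 2)))
        + ε * ((1 - m) * ((-m) * x ^ (-m - 1)))))
      ?_ ?_ ?_ ?_ ?_ ?_ ?_ ?_ r ⟨hr₁r.le, hrr₂.le⟩ t ⟨hat, le_rfl⟩
    · linarith
    · refine (hcont.mono hsubset).sub ?_
      refine ContinuousOn.add (continuousOn_const.mul (ContinuousOn.rpow_const (by fun_prop) ?_))
        (continuousOn_const.mul ((ContinuousOn.rpow_const (by fun_prop) ?_).add (by fun_prop)))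
      · exact fun p hp => Or.inl (hpos _ (hsubset hp).1 _ hp.2.1).ne'
      · exact fun p hp => Or.inl (ne_of_gt (hsubset hp).1)
    · intro x hx s hs
      have hx0 : 0 < x := hr₁pos.trans hx.1
      have h1 : HasDerivAt (fun s : ℝ => x ^ 2 + c * (s - a)) c s := by
        simpa using (((hasDerivAt_id s).sub_const a).const_mul c).const_add (x ^ 2)
      have h2 := (h1.rpow_const (p := -k) (Or.inl (hpos x hx0 s hs.1.le).ne')).const_mul C
      have h3 : HasDerivAt (fun s : ℝ => ε * (x ^ (1 - m) + (1 + (s - a)))) ε s := by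
        simpa using ((((hasDerivAt_id s).sub_const a).const_add 1).const_add
          (x ^ (1 - m))).const_mul ε
      exact ((ht x hx0 s (hs.2.trans ht0)).mono (Iic_subset_Iic.2 (hs.2.trans ht0))).sub
        (h2.add h3).hasDerivWithinAt
    · intro x hx s hs
      have hx0 : 0 < x := hr₁pos.trans hx.1
      have h2 := (hasDerivAt_sq_add_rpow (hpos x hx0 s hs.1.le) (-k)).const_mul C
      have h3 := ((Real.hasDerivAt_rpow_const (p := 1 - m) (Or.inl hx0.ne')).add_const
          (1 + (s - a))).const_mul ε
      rw [show 1 - m - 1 = -m by ring] at h3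
      exact (hr x hx0 s (hs.2.trans ht0)).sub (h2.add h3)
    · intro x hx s hs
      have hx0 : 0 < x := hr₁pos.trans hx.1
      have h1 := hasDerivAt_sq_add_rpow (hpos x hx0 s hs.1.le) (-k - 1)
      rw [show -k - 1 - 1 = -k - 2 by ring] at h1
      have h0 : HasDerivAt (fun y : ℝ => 2 * y * (-k)) (2 * (-k)) x := by
        simpa using ((hasDerivAt_id x).const_mul 2).mul_const (-k)
      have h3 := ((Real.hasDerivAt_rpow_const (p := -m) (Or.inl hx0.ne')).const_mul
          (1 - m)).const_mul ε
      exact (hrr x hx0 s (hs.2.trans ht0)).sub (((h0.mul h1).const_mul C).add h3)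
    · intro x hx s hs
      have hx0 : 0 < x := hr₁pos.trans hx.1
      have hq := hpos x hx0 s hs.1.le
      have hA : 0 ≤ c * (s - a) := mul_nonneg hc0.le (sub_nonneg.2 hs.1.le)
      rw [heq x hx0 s (hs.2.trans ht0)]
      have e1 : (x ^ 2 + c * (s - a)) ^ (-k - 1)
          = (x ^ 2 + c * (s - a)) * (x ^ 2 + c * (s - a)) ^ (-k - 2) := by
        rw [show -k - 1 = 1 + (-k - 2) by ring, Real.rpow_add hq, Real.rpow_one]
      have e2 : x ^ (-m) = x * x ^ (-m - 1) := by
        rw [show -m = 1 + (-m - 1) by ring, Real.rpow_add hx0, Real.rpow_one]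
        ring_nf
      rw [e1, e2]
      have hQ : 0 ≤ C * k * (x ^ 2 + c * (s - a)) ^ (-k - 2) * (4 * (k + 1) * (c * (s - a))) := by
        have := Real.rpow_nonneg hq.le (-k - 2)
        positivity
      have e3 : ∀ P R : ℝ, m / x * (vr x s - (C * (2 * x * -k * P) + ε * ((1 - m) * (x * R))))
          = m / x * vr x s - (C * (2 * m * -k * P) + ε * ((1 - m) * (m * R))) := by
        intro P R
        field_simp
      rw [e3]
      generalize (x ^ 2 + c * (s - a)) ^ (-k - 2) = Q at *
      generalize x ^ (-m - 1) = R at *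
      generalize m / x * vr x s = V at *
      generalize c * (s - a) = A at *
      rw [hc]
      nlinarith
    · intro s hs
      have h1 := hle r₁ hr₁pos s (hs.2.trans ht0)
      have h2 := hB r₁ hr₁pos s hs.1
      have h3 : C * r₁ ^ (-(2 * k)) ≤ ε * r₁ ^ (1 - m) := by
        rw [show -(2 * k) = (m - 1 - 2 * k) + (1 - m) by ring, Real.rpow_add hr₁pos, ← mul_assoc]
        exact mul_le_mul_of_nonneg_right hr₁.le (Real.rpow_nonneg hr₁pos.le _)
      have h4 : 0 ≤ ε * (1 + (s - a)) := mul_nonneg hε.le (by linarith [hs.1])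
      linarith
    · intro s hs
      have hr₂pos := hr0.trans hrr₂
      have h1 := hle r₂ hr₂pos s (hs.2.trans ht0)
      have h2 := hB r₂ hr₂pos s hs.1
      have h3 : 0 ≤ ε * r₂ ^ (1 - m) := by positivity
      have h4 : 0 ≤ ε * (s - a) := mul_nonneg hε.le (by linarith [hs.1])
      linarith
    · intro x hx
      have hx0 : 0 < x := hr₁pos.trans_le hx.1
      have h1 := hle x hx0 a (hat.trans ht0)
      have h2 : (x ^ 2 + c * (a - a)) ^ (-k) = x ^ (-(2 * k)) := by
        rw [sub_self, mul_zero, add_zero, ← Real.rpow_natCast, ← Real.rpow_mul hx0.le]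
        congr 1
        push_cast
        ring
      have h3 : 0 ≤ ε * (x ^ (1 - m) + (1 + (a - a))) := by
        rw [sub_self]; positivity
      rw [h2]
      linarith
  have hlim : Tendsto (fun ε : ℝ => C * (r ^ 2 + c * (t - a)) ^ (-k)
      + ε * (r ^ (1 - m) + (1 + (t - a)))) (𝓝[>] 0)
      (𝓝 (C * (r ^ 2 + c * (t - a)) ^ (-k))) := by
    have : Continuous (fun ε : ℝ => C * (r ^ 2 + c * (t - a)) ^ (-k)
      + ε * (r ^ (1 - m) + (1 + (t - a)))) := by fun_prop
    simpa using (this.tendsto 0).mono_left (nhdsWithin_le_nhds (s := Ioi 0))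
  exact ge_of_tendsto hlim (eventually_mem_nhdsWithin.mono fun ε hε => key ε hε)

/-- An ancient solution of the radial heat equation in (fractional) dimension `m + 1` on `r > 0`
bounded above by `C r^{-2k}` with `0 < 2k < m - 1` is nonpositive. -/
lemma ancient_radial_heat_nonpos {v vt vr vrr : ℝ → ℝ → ℝ} {m k C : ℝ} (hC : 0 < C) (hk : 0 < k)
    (hkm : 2 * k < m - 1)
    (hcont : ContinuousOn (fun p : ℝ × ℝ => v p.1 p.2) (Ioi 0 ×ˢ Iic 0))
    (ht : ∀ r, 0 < r → ∀ t ≤ 0, HasDerivWithinAt (v r) (vt r t) (Iic 0) t)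
    (hr : ∀ r, 0 < r → ∀ t ≤ 0, HasDerivAt (fun x => v x t) (vr r t) r)
    (hrr : ∀ r, 0 < r → ∀ t ≤ 0, HasDerivAt (fun x => vr x t) (vrr r t) r)
    (heq : ∀ r, 0 < r → ∀ t ≤ 0, vt r t = vrr r t + m / r * vr r t)
    (hle : ∀ r, 0 < r → ∀ t ≤ 0, v r t ≤ C * r ^ (-(2 * k)))
    {r t : ℝ} (hr0 : 0 < r) (ht0 : t ≤ 0) : v r t ≤ 0 := by
  have hc0 : 0 < 2 * (m - 1 - 2 * k) := by linarith
  have h1 : Tendsto (fun a : ℝ => r ^ 2 + 2 * (m - 1 - 2 * k) * (t - a)) atBot atTop := by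
    refine tendsto_atTop_add_const_left _ _ (Tendsto.const_mul_atTop hc0 ?_)
    exact (tendsto_atTop_add_const_left atBot t tendsto_neg_atBot_atTop).congr
      fun a => (sub_eq_add_neg t a).symm
  have h2 := ((tendsto_rpow_neg_atTop hk).comp h1).const_mul C
  rw [mul_zero] at h2
  refine ge_of_tendsto h2 ?_
  filter_upwards [eventually_le_atBot t] with a ha
  exact radial_heat_le_barrier hC hk hkm hcont ht hr hrr heq hle hr0 ha ht0

/-- vanishing theorem on the Lawson cone.  A smooth, radially symmetric,
ancient solution of the Jacobi equation `∂_t u = ∂_r² u + ((n−2)/r) ∂_r u + ((n−2)/r²) u`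
on `(0, ∞) × (−∞, 0]` with `|u(r, t)| ≤ C r^{α−δ}` for some `0 < δ < n − 3 + 2α` is
identically zero. -/
theorem stmt_14 (n : ℕ) (hn : 8 ≤ n)
    (α : ℝ)
    (hα : α = (3 - (n : ℝ) + Real.sqrt ((n : ℝ) ^ 2 - 10 * (n : ℝ) + 17)) / 2)
    (C δ : ℝ) (hC : 0 < C) (hδ₀ : 0 < δ) (hδ₁ : δ < (n : ℝ) - 3 + 2 * α)
    (u : ℝ → ℝ → ℝ)
    (hu : ContDiffOn ℝ (⊤ : ℕ∞) (fun pt : ℝ × ℝ => u pt.1 pt.2) (Ioi 0 ×ˢ Iic 0))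
    (hpde : ∀ r : ℝ, 0 < r → ∀ t : ℝ, t ≤ 0 →
      derivWithin (fun t' => u r t') (Iic 0) t
        = deriv (deriv (fun r' => u r' t)) r
          + (((n : ℝ) - 2) / r) * deriv (fun r' => u r' t) r
          + (((n : ℝ) - 2) / r ^ 2) * u r t)
    (hbound : ∀ r : ℝ, 0 < r → ∀ t : ℝ, t ≤ 0 → |u r t| ≤ C * r ^ (α - δ)) :
    ∀ r : ℝ, 0 < r → ∀ t : ℝ, t ≤ 0 → u r t = 0 := by
  have hn' : (8 : ℝ) ≤ n := by exact_mod_cast hn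
  have hroot : α * (α - 1) + ((n : ℝ) - 2) * (α + 1) = 0 := by
    have hD : 0 ≤ (n : ℝ) ^ 2 - 10 * (n : ℝ) + 17 := by nlinarith
    have hs := Real.sq_sqrt hD
    rw [hα]
    linear_combination hs / 4
  have hu_r : ∀ t ≤ 0, ContDiffOn ℝ (⊤ : ℕ∞) (fun r => u r t) (Ioi 0) := fun t ht =>
    hu.comp (f := fun r : ℝ => (r, t)) (by fun_prop) fun r hr => ⟨hr, ht⟩
  have hu_t : ∀ r, 0 < r → ContDiffOn ℝ (⊤ : ℕ∞) (fun t => u r t) (Iic 0) := fun r hr =>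
    hu.comp (f := fun t : ℝ => (r, t)) (by fun_prop) fun t ht => ⟨hr, ht⟩
  have dt : ∀ r, 0 < r → ∀ t ≤ 0,
      HasDerivWithinAt (fun t' => u r t') (derivWithin (fun t' => u r t') (Iic 0) t) (Iic 0) t :=
    fun r hr t ht => ((hu_t r hr).differentiableOn (by simp) t ht).hasDerivWithinAt
  have dr : ∀ r, 0 < r → ∀ t ≤ 0,
      HasDerivAt (fun r' => u r' t) (deriv (fun r' => u r' t) r) r := fun r hr t ht =>
    (((hu_r t ht).differentiableOn (by simp)).differentiableAt (Ioi_mem_nhds hr)).hasDerivAt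
  have drr : ∀ r, 0 < r → ∀ t ≤ 0, HasDerivAt (fun r' => deriv (fun x => u x t) r')
      (deriv (deriv (fun r' => u r' t)) r) r := fun r hr t ht =>
    ((((hu_r t ht).deriv_of_isOpen (m := (⊤ : ℕ∞)) isOpen_Ioi le_rfl).differentiableOn
      (by simp)).differentiableAt (Ioi_mem_nhds hr)).hasDerivAt
  have hsign : ∀ σ : ℝ, |σ| = 1 → ∀ r, 0 < r → ∀ t ≤ 0, σ * (r ^ (-α) * u r t) ≤ 0 := by
    intro σ hσ r hr t ht
    refine ancient_radial_heat_nonpos (m := (n : ℝ) - 2 + 2 * α) (k := δ / 2) (C := C)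
      (v := fun x s => σ * (x ^ (-α) * u x s))
      (vt := fun x s => σ * (x ^ (-α) * derivWithin (fun t' => u x t') (Iic 0) s))
      (vr := fun x s => σ * (-α * x ^ (-α - 1) * u x s
        + x ^ (-α) * deriv (fun r' => u r' s) x))
      (vrr := fun x s => σ * ((-α * ((-α - 1) * x ^ (-α - 1 - 1)) * u x s
          + -α * x ^ (-α - 1) * deriv (fun r' => u r' s) x)
        + (-α * x ^ (-α - 1) * deriv (fun r' => u r' s) x
          + x ^ (-α) * deriv (deriv (fun r' => u r' s)) x)))
      hC (by linarith) (by linarith) ?_ ?_ ?_ ?_ ?_ ?_ hr ht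
    · refine continuousOn_const.mul ((ContinuousOn.rpow_const (by fun_prop) ?_).mul hu.continuousOn)
      exact fun p hp => Or.inl (ne_of_gt hp.1)
    · exact fun x hx s hs => ((dt x hx s hs).const_mul _).const_mul _
    · exact fun x hx s hs =>
        ((Real.hasDerivAt_rpow_const (Or.inl hx.ne')).mul (dr x hx s hs)).const_mul _
    · exact fun x hx s hs =>
        (((((Real.hasDerivAt_rpow_const (Or.inl hx.ne')).const_mul (-α)).mul (dr x hx s hs))).add
          ((Real.hasDerivAt_rpow_const (Or.inl hx.ne')).mul (drr x hx s hs))).const_mul _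
    · intro x hx s hs
      rw [hpde x hx s hs, Real.rpow_sub_one hx.ne', Real.rpow_sub_one hx.ne']
      field_simp
      linear_combination σ * u x s * hroot
    · intro x hx s hs
      calc σ * (x ^ (-α) * u x s) ≤ |σ * (x ^ (-α) * u x s)| := le_abs_self _
        _ = x ^ (-α) * |u x s| := by
          rw [abs_mul, abs_mul, hσ, one_mul, abs_of_nonneg (Real.rpow_nonneg hx.le _)]
        _ ≤ x ^ (-α) * (C * x ^ (α - δ)) :=
          mul_le_mul_of_nonneg_left (hbound x hx s hs) (Real.rpow_nonneg hx.le _)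
        _ = C * x ^ (-(2 * (δ / 2))) := by
          rw [show -(2 * (δ / 2)) = -α + (α - δ) by ring, Real.rpow_add hx]
          ring
  intro r hr t ht
  have h1 := hsign 1 (by simp) r hr t ht
  have h2 := hsign (-1) (by simp) r hr t ht
  have h3 : r ^ (-α) * u r t = 0 := by linarith
  exact (mul_eq_zero.1 h3).resolve_left (Real.rpow_pos_of_pos hr _).ne'
end

section
/- Let p, q ≥ 2 be integers with p + q = n and μ = √((q − 1)/(p − 1)), let l ≥ 2 be an integer, and let B > 0. Suppose y > 0 and v₀, v₁, v₂ ∈ ℝ satisfy |v₀/y| ≤ (1/2) min{μ, μ⁻¹}, |v₁| ≤ (1/2) min{μ, μ⁻¹}, and y^i |v_i| ≤ B (y^α + y^{2λ_l + 1}) for i = 0, 1, 2. Then the quantity Q = −(v₁²/(1 + v₁²)) v₂ + (n − 2) · [ (v₀/y)² (v₀/y² + v₁/y) + (μ − μ⁻¹)(v₀/y)(v₀/y²) ] / [ (1 − μ v₀/y)(1 + μ⁻¹ v₀/y) ] satisfies |Q| ≤ C B² y^{−3} (y^{2α} + y^{4λ_l + 2}) for a constant C depending only on p and q. -/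
/-- If `|a| ≤ 1/2` and `|b| ≤ 1/2`, then `(1 - a) * (1 + b)` is at least `1/4`. -/
lemma quarter_le_one_sub_mul_one_add {a b : ℝ} (ha : |a| ≤ 1 / 2) (hb : |b| ≤ 1 / 2) :
    1 / 4 ≤ (1 - a) * (1 + b) := by
  obtain ⟨_, ha⟩ := abs_le.1 ha
  obtain ⟨hb, _⟩ := abs_le.1 hb
  nlinarith

lemma abs_curvature_term_le {a b y N : ℝ} (ha : |a| ≤ 1 / 2) (haN : |a| ≤ N)
    (hb : |b| ≤ N / y) : |-(a ^ 2 / (1 + a ^ 2)) * b| ≤ N ^ 2 / y := by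
  have hN : 0 ≤ N := (abs_nonneg a).trans haN
  have h : |a ^ 2 / (1 + a ^ 2)| ≤ N := by
    rw [abs_of_nonneg (by positivity)]
    have h1 : a ^ 2 / (1 + a ^ 2) ≤ a ^ 2 := div_le_self (sq_nonneg a) (by nlinarith [sq_nonneg a])
    nlinarith [sq_abs a, abs_nonneg a]
  calc |-(a ^ 2 / (1 + a ^ 2)) * b| = |a ^ 2 / (1 + a ^ 2)| * |b| := by rw [abs_mul, abs_neg]
    _ ≤ N * (N / y) := by gcongr
    _ = N ^ 2 / y := by ring

lemma abs_lower_order_term_le {w a d e y N k : ℝ} (hy : 0 < y) (hk : 0 ≤ k) (hw : |w| ≤ 1 / 2)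
    (ha : |a| ≤ 1 / 2) (hwN : |w| ≤ N) (he : 1 / 4 ≤ e) :
    |k * (w ^ 2 * (w / y + a / y) + d * w * (w / y)) / e|
      ≤ 4 * k * (1 + |d|) * (N ^ 2 / y) := by
  have he0 : 0 < e := by linarith
  have h1 : |w + a + d| ≤ 1 + |d| :=
    (abs_add_le _ _).trans (by linarith [abs_add_le w a])
  have h2 : |w| ^ 2 ≤ N ^ 2 := by gcongr
  have h3 : e⁻¹ ≤ 4 := by
    rw [inv_le_comm₀ he0 (by norm_num)]; linarith
  have h4 : k * (w ^ 2 * (w / y + a / y) + d * w * (w / y)) / e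
      = k * (w ^ 2 * (w + a + d) / y) * e⁻¹ := by
    field_simp
  rw [h4, abs_mul, abs_mul, abs_div, abs_mul, abs_pow, abs_of_nonneg hk, abs_of_pos hy,
    abs_of_pos (inv_pos.2 he0)]
  calc k * (|w| ^ 2 * |w + a + d| / y) * e⁻¹ ≤ k * (N ^ 2 * (1 + |d|) / y) * 4 := by gcongr
    _ = 4 * k * (1 + |d|) * (N ^ 2 / y) := by ring

lemma min_self_inv_le_one (μ : ℝ) : min μ μ⁻¹ ≤ 1 := by
  rcases le_total μ 1 with h | h
  · exact (min_le_left _ _).trans h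
  · exact (min_le_right _ _).trans (inv_le_one_of_one_le₀ h)

lemma rpow_add_rpow_sq_le {y : ℝ} (hy : 0 < y) (a b : ℝ) :
    (y ^ a + y ^ b) ^ 2 ≤ 2 * (y ^ (2 * a) + y ^ (2 * b)) := by
  rw [two_mul a, two_mul b, Real.rpow_add hy, Real.rpow_add hy]
  nlinarith [sq_nonneg (y ^ a - y ^ b)]

/-- pointwise bound for the quadratic remainder `𝒬v` of the type-I rescaled
mean curvature flow equation, with a constant depending only on `p` and `q`. -/
theorem stmt_15 (n p q : ℕ) (hn : 8 ≤ n) (hp : 2 ≤ p) (hq : 2 ≤ q) (hpq : p + q = n)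
    (α μ : ℝ)
    (hα : α = (3 - (n : ℝ) + Real.sqrt ((n : ℝ) ^ 2 - 10 * (n : ℝ) + 17)) / 2)
    (hμ : μ = Real.sqrt (((q : ℝ) - 1) / ((p : ℝ) - 1))) :
    ∃ C : ℝ, 0 < C ∧
      ∀ (l : ℕ), 2 ≤ l → ∀ lamₗ : ℝ, lamₗ = -(1 - α) / 2 + (l : ℝ) →
      ∀ B : ℝ, 0 < B → ∀ y : ℝ, 0 < y → ∀ v₀ v₁ v₂ : ℝ,
        |v₀ / y| ≤ (1 / 2) * min μ μ⁻¹ →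
        |v₁| ≤ (1 / 2) * min μ μ⁻¹ →
        |v₀| ≤ B * (y ^ α + y ^ (2 * lamₗ + 1)) →
        y * |v₁| ≤ B * (y ^ α + y ^ (2 * lamₗ + 1)) →
        y ^ 2 * |v₂| ≤ B * (y ^ α + y ^ (2 * lamₗ + 1)) →
        |(-(v₁ ^ 2 / (1 + v₁ ^ 2)) * v₂
          + ((n : ℝ) - 2) * ((v₀ / y) ^ 2 * (v₀ / y ^ 2 + v₁ / y)
              + (μ - μ⁻¹) * (v₀ / y) * (v₀ / y ^ 2))
            / ((1 - μ * (v₀ / y)) * (1 + μ⁻¹ * (v₀ / y))))|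
          ≤ C * B ^ 2 * y ^ (-3 : ℝ) * (y ^ (2 * α) + y ^ (4 * lamₗ + 2)) := by
  have hμ0 : 0 < μ := by
    have h1 : (2 : ℝ) ≤ p := by exact_mod_cast hp
    have h2 : (2 : ℝ) ≤ q := by exact_mod_cast hq
    rw [hμ]
    exact Real.sqrt_pos.2 (div_pos (by linarith) (by linarith))
  have hk : (0 : ℝ) ≤ (n : ℝ) - 2 := by
    have : (8 : ℝ) ≤ n := by exact_mod_cast hn
    linarith
  set K : ℝ := 1 + 4 * ((n : ℝ) - 2) * (1 + |μ - μ⁻¹|) with hK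
  have hK0 : 0 < K := by positivity
  refine ⟨2 * K, by positivity, ?_⟩
  intro l _ lam _ B _ y hy v₀ v₁ v₂ h0 h1 hv0 hv1 hv2
  set S : ℝ := y ^ α + y ^ (2 * lam + 1) with hS
  have hmin := min_self_inv_le_one μ
  have hN0 : |v₀ / y| ≤ B * S / y := by
    rw [abs_div, abs_of_pos hy]
    gcongr
  have hN1 : |v₁| ≤ B * S / y := by
    rw [le_div_iff₀ hy]
    linarith
  have hN2 : |v₂| ≤ B * S / y / y := by
    rw [div_div, le_div_iff₀ (by positivity)]
    linarith
  have hden : 1 / 4 ≤ (1 - μ * (v₀ / y)) * (1 + μ⁻¹ * (v₀ / y)) := by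
    apply quarter_le_one_sub_mul_one_add
    · rw [abs_mul, abs_of_pos hμ0]
      calc μ * |v₀ / y| ≤ μ * (1 / 2 * μ⁻¹) := by
            gcongr
            exact h0.trans (by gcongr; exact min_le_right _ _)
        _ = 1 / 2 := by field_simp
    · rw [abs_mul, abs_of_pos (inv_pos.2 hμ0)]
      calc μ⁻¹ * |v₀ / y| ≤ μ⁻¹ * (1 / 2 * μ) := by
            gcongr
            exact h0.trans (by gcongr; exact min_le_left _ _)
        _ = 1 / 2 := by field_simp
  have hT1 := abs_curvature_term_le (by linarith) hN1 hN2
  have hT2 := abs_lower_order_term_le (d := μ - μ⁻¹) hy hk (by linarith)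
    (h1.trans (by linarith)) hN0 hden
  have hsq : v₀ / y ^ 2 = v₀ / y / y := by rw [div_div, sq]
  have hpow : y ^ (-3 : ℝ) = (y ^ 3)⁻¹ := by
    rw [Real.rpow_neg hy.le]
    norm_cast
  have hexp : 4 * lam + 2 = 2 * (2 * lam + 1) := by ring
  rw [hsq, hpow, hexp]
  calc _ ≤ K * ((B * S / y) ^ 2 / y) := by
        refine (abs_add_le _ _).trans ((add_le_add hT1 hT2).trans_eq ?_)
        rw [hK]; ring
    _ = K * B ^ 2 * (y ^ 3)⁻¹ * S ^ 2 := by field_simp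
    _ ≤ K * B ^ 2 * (y ^ 3)⁻¹ * (2 * (y ^ (2 * α) + y ^ (2 * (2 * lam + 1)))) := by
        gcongr
        exact rpow_add_rpow_sq_le hy _ _
    _ = _ := by ring
end

section
/- Let λ < 0, s₁ ∈ ℝ, C₁ ≥ 0, let g : [s₁, ∞) → ℝ be continuous with |g(s)| ≤ C₁ e^{2λs} for all s ≥ s₁, and let U : [s₁, ∞) → ℝ be differentiable with U'(s) = λ U(s) + g(s) for all s ≥ s₁ and e^{−λs} U(s) → 0 as s → ∞. Then |U(s)| ≤ (C₁/(−λ)) e^{2λs} for all s ≥ s₁. -/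
open Set Filter

/-- A solution of `U' = λU + g` on `[a, ∞)` with `λ < 0`, `g(s) ≥ −C e^{2λs}` and
`e^{−λs} U(s) → 0` at infinity satisfies `U(s) ≤ (C/(−λ)) e^{2λs}`. -/
theorem le_exp_of_hasDerivWithinAt_of_tendsto_zero {lam a C : ℝ} (hlam : lam < 0) {g U : ℝ → ℝ}
    (hg : ∀ s, a ≤ s → -(C * Real.exp (2 * lam * s)) ≤ g s)
    (hU : ∀ s, a ≤ s → HasDerivWithinAt U (lam * U s + g s) (Ici a) s)
    (hdecay : Tendsto (fun s => Real.exp (-lam * s) * U s) atTop (nhds 0))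
    {s : ℝ} (hs : a ≤ s) : U s ≤ C / (-lam) * Real.exp (2 * lam * s) := by
  have hexp (c t : ℝ) : HasDerivAt (fun s => Real.exp (c * s)) (Real.exp (c * t) * c) t := by
    simpa using ((hasDerivAt_id t).const_mul c).exp
  have hsplit (t : ℝ) : Real.exp (lam * t) = Real.exp (-lam * t) * Real.exp (2 * lam * t) := by
    rw [← Real.exp_add]
    ring_nf
  let W : ℝ → ℝ := fun s => Real.exp (-lam * s) * U s + C / lam * Real.exp (lam * s)
  have hWd (t : ℝ) (ht : a ≤ t) : HasDerivWithinAt W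
      (Real.exp (-lam * t) * (g t + C * Real.exp (2 * lam * t))) (Ici a) t := by
    refine (((hexp (-lam) t).hasDerivWithinAt.mul (hU t ht)).add
      ((hexp lam t).hasDerivWithinAt.const_mul (C / lam))).congr_deriv ?_
    rw [hsplit]
    field_simp [hlam.ne]
    ring
  have hmono : MonotoneOn W (Ici a) := by
    refine monotoneOn_of_hasDerivWithinAt_nonneg (convex_Ici a)
      (fun t ht => (hWd t ht).continuousWithinAt)
      (fun t ht => (hWd t (interior_subset ht)).mono interior_subset) fun t ht => ?_
    have := hg t (interior_subset ht)
    exact mul_nonneg (Real.exp_pos _).le (by linarith)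
  have hlim : Tendsto W atTop (nhds 0) := by
    have h := Real.tendsto_exp_atBot.comp (tendsto_id.const_mul_atTop_of_neg hlam)
    simpa [W] using hdecay.add (h.const_mul (C / lam))
  have hW : W s ≤ 0 := ge_of_tendsto hlim <| by
    filter_upwards [eventually_ge_atTop s] with t ht
    exact hmono hs (hs.trans ht) ht
  simp only [W, hsplit] at hW
  have h : Real.exp (-lam * s) * (U s - C / (-lam) * Real.exp (2 * lam * s)) ≤ 0 := by
    rw [div_neg]
    linarith
  exact sub_nonpos.1 (nonpos_of_mul_nonpos_right h (Real.exp_pos _))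

/-- a solution of `U' = λU + g` on `[s₁, ∞)` with `λ < 0`,
`|g(s)| ≤ C₁ e^{2λs}` and `e^{−λs} U(s) → 0` at infinity satisfies
`|U(s)| ≤ (C₁/(−λ)) e^{2λs}`. -/
theorem stmt_16 (lam s₁ C₁ : ℝ) (hlam : lam < 0) (hC₁ : 0 ≤ C₁)
    (g U : ℝ → ℝ)
    (hg : ContinuousOn g (Ici s₁))
    (hgb : ∀ s : ℝ, s₁ ≤ s → |g s| ≤ C₁ * Real.exp (2 * lam * s))
    (hU : ∀ s : ℝ, s₁ ≤ s → HasDerivWithinAt U (lam * U s + g s) (Ici s₁) s)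
    (hdecay : Tendsto (fun s => Real.exp (-lam * s) * U s) atTop (nhds 0)) :
    ∀ s : ℝ, s₁ ≤ s → |U s| ≤ (C₁ / (-lam)) * Real.exp (2 * lam * s) := by
  intro s hs
  refine abs_le'.2 ⟨le_exp_of_hasDerivWithinAt_of_tendsto_zero hlam
    (fun t ht => (abs_le.1 (hgb t ht)).1) hU hdecay hs,
    le_exp_of_hasDerivWithinAt_of_tendsto_zero (g := fun t => -g t) (U := fun t => -U t) hlam
      (fun t ht => neg_le_neg (abs_le.1 (hgb t ht)).2) (fun t ht => ?_) ?_ hs⟩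
  · exact (hU t ht).neg.congr_deriv (by ring)
  · simpa using hdecay.neg
end

section
/- For integers n ≥ 8 and l ≥ 2 the following are equivalent: (i) there exists a ∈ ℝ with −α < a < 1 − α and λ_l (1 − a/(1 − α)) − 1/2 ≥ 0; (ii) λ_l > (1 − α)/2; (iii) l > 1 − α; (iv) either n ≥ 9 and l ≥ 3, or n = 8 and l ≥ 4. -/
/-- for integers `n ≥ 8` and `l ≥ 2`, the following are equivalent:
(i) there exists `a` with `−α < a < 1 − α` and `λ_l (1 − a/(1−α)) − 1/2 ≥ 0`;
(ii) `λ_l > (1−α)/2`; (iii) `l > 1 − α`; (iv) `n ≥ 9 ∧ l ≥ 3` or `n = 8 ∧ l ≥ 4`. -/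
theorem stmt_18 (n l : ℕ) (hn : 8 ≤ n) (hl : 2 ≤ l)
    (α lamₗ : ℝ)
    (hα : α = (3 - (n : ℝ) + Real.sqrt ((n : ℝ) ^ 2 - 10 * (n : ℝ) + 17)) / 2)
    (hlamₗ : lamₗ = -(1 - α) / 2 + (l : ℝ)) :
    ((∃ a : ℝ, -α < a ∧ a < 1 - α ∧ 0 ≤ lamₗ * (1 - a / (1 - α)) - 1 / 2)
        ↔ (1 - α) / 2 < lamₗ) ∧
    ((1 - α) / 2 < lamₗ ↔ 1 - α < (l : ℝ)) ∧
    (1 - α < (l : ℝ) ↔ (9 ≤ n ∧ 3 ≤ l) ∨ (n = 8 ∧ 4 ≤ l)) := by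
  have hn' : (8 : ℝ) ≤ n := by exact_mod_cast hn
  have hl' : (2 : ℝ) ≤ l := by exact_mod_cast hl
  have h_neg : α < -1 := by
    have : √((n : ℝ) ^ 2 - 10 * n + 17) < n - 5 :=
      (Real.sqrt_lt' (by linarith)).2 (by nlinarith)
    linarith
  have h_ge : -2 ≤ α := by
    have : (n : ℝ) - 7 ≤ √((n : ℝ) ^ 2 - 10 * n + 17) :=
      Real.le_sqrt_of_sq_le (by nlinarith)
    linarith
  have hc : 0 < 1 - α := by linarith
  have hlam : 0 < lamₗ := by linarith
  refine ⟨⟨?_, fun h => ?_⟩, ⟨fun h => by linarith, fun h => by linarith⟩, ?_⟩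
  · rintro ⟨a, ha, -, h⟩
    have h_mul : lamₗ * (1 - a / (1 - α)) * (1 - α) = lamₗ * (1 - α - a) := by
      field_simp
    have h_le : 1 / 2 * (1 - α) ≤ lamₗ * (1 - α - a) := by
      rw [← h_mul]
      exact mul_le_mul_of_nonneg_right (by linarith) hc.le
    nlinarith
  · have h_lt : (1 - α) / (2 * lamₗ) < 1 := (div_lt_one (by linarith)).2 (by linarith)
    have h_pos : 0 < (1 - α) / (2 * lamₗ) := by positivity
    refine ⟨1 - α - (1 - α) / (2 * lamₗ), by linarith, by linarith, le_of_eq ?_⟩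
    field_simp
    ring
  · rcases hn.eq_or_lt with rfl | h_lt
    · have h_eq : α = -2 := by
        rw [hα]
        norm_num
      rw [h_eq]
      norm_num
      exact_mod_cast Iff.rfl
    · have hn9 : (9 : ℝ) ≤ n := by exact_mod_cast h_lt
      have h_gt : -2 < α := by
        have : (n : ℝ) - 7 < √((n : ℝ) ^ 2 - 10 * n + 17) :=
          Real.lt_sqrt_of_sq_lt (by nlinarith)
        linarith
      constructor
      · intro h
        have : (2 : ℝ) < l := by linarith
        exact Or.inl ⟨h_lt, by exact_mod_cast this⟩
      · rintro (⟨-, h⟩ | ⟨h, -⟩)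
        · have : (3 : ℝ) ≤ l := by exact_mod_cast h
          linarith
        · omega
end
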